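/- arXiv:2312.09101 — 3 statements merged into one kernel-verified Lean document; each statement's English description precedes it below -/
import Mathlib

section
/- Let G = (X,E) be a tree without dead ends and z ∈ ℂ ∖ {0}. Then the map μ ↦ p_z·(B*μ) is a linear isomorphism from D'(Ω) onto the eigenspace E_z(L'; D'(𝔓)) = {λ ∈ D'(𝔓) | L'λ = z·λ}. -/
open Function Set
open scoped Classical

namespace GraphQCC

variable {X : Type} (G : SimpleGraph X)

/-- The set of directed edges of a (symmetric, loopless) graph. -/
abbrev DE := {p : X × X // G.Adj p.1 p.2}

variable {G}

/-- Initial vertex of a directed edge. -/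
def ini (e : DE G) : X := e.1.1

/-- Terminal vertex of a directed edge. -/
def ter (e : DE G) : X := e.1.2

/-- Opposite edge. -/
def op (e : DE G) : DE G := ⟨(e.1.2, e.1.1), e.2.symm⟩

variable (G)

/-- Degree of a vertex: the number of directed edges starting at it. -/
noncomputable def deg (x : X) : ℕ := Set.ncard {e : DE G | ini e = x}

/-- The graph is locally finite: every vertex has finite degree. -/
def LocFin : Prop := ∀ x : X, {e : DE G | ini e = x}.Finite

/-- The edge Laplacian. -/
noncomputable def edgeLap (f : DE G → ℂ) (e : DE G) : ℂ :=
  ∑ᶠ e' ∈ {e' : DE G | ini e' = ter e ∧ e' ≠ op e}, f e'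

/-- The `z`-eigenspace of the edge Laplacian, as a set of functions on directed edges. -/
def edgeEig (z : ℂ) : Set (DE G → ℂ) := {f | ∀ e, edgeLap G f e = z * f e}

/-- The edge inversion operator Ξ. -/
def Xi (f : DE G → ℂ) (e : DE G) : ℂ := f (op e)

/-- The operator Σ (sum over edges with the same initial point). -/
noncomputable def Sig (f : DE G → ℂ) (e : DE G) : ℂ :=
  ∑ᶠ e' ∈ {e' : DE G | ini e' = ini e}, f e'

/-- Edges pointing away from a vertex `o`. -/
def away (o : X) : Set (DE G) := {e | G.dist o (ter e) = G.dist o (ini e) + 1}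

/-- The edge Laplacian on functions on the edges pointing away from `o`. -/
noncomputable def edgeLapAway (o : X) (f : ↥(away G o) → ℂ) (e : ↥(away G o)) : ℂ :=
  ∑ᶠ e' ∈ {e' : ↥(away G o) | ini e'.1 = ter e.1 ∧ e'.1 ≠ op e.1}, f e'

/-- The `z`-eigenspace of the edge Laplacian on edges pointing away from `o`. -/
def edgeEigAway (o : X) (z : ℂ) : Set (↥(away G o) → ℂ) :=
  {f | ∀ e, edgeLapAway G o f e = z * f e}

/-! ## Boundary at infinity -/

/-- A ray: an infinite non-backtracking chain of vertices. -/
def IsRay (r : ℕ → X) : Prop := (∀ n, G.Adj (r n) (r (n + 1))) ∧ ∀ n, r (n + 2) ≠ r n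

abbrev Ray := {r : ℕ → X // IsRay G r}

/-- Two rays are equivalent if they share infinitely many vertices. -/
def RayRel (r r' : Ray G) : Prop := (Set.range r.1 ∩ Set.range r'.1).Infinite

/-- The boundary at infinity: equivalence classes of rays. -/
def Boundary := Quot (RayRel G)

/-- The set `∂₊ e` of boundary points reachable by a non-backtracking chain starting with `e`. -/
def plusBd (e : DE G) : Set (Boundary G) :=
  {ω | ∃ r : Ray G, Quot.mk (RayRel G) r = ω ∧ r.1 0 = ini e ∧ r.1 1 = ter e}

/-- The topology on the boundary generated by the sets `∂₊ e`. -/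
instance : TopologicalSpace (Boundary G) :=
  TopologicalSpace.generateFrom {s | ∃ e : DE G, s = plusBd G e}

/-- The space of locally constant functions on the boundary. -/
noncomputable def Clc : Submodule ℂ (Boundary G → ℂ) where
  carrier := {f | IsLocallyConstant f}
  add_mem' hf hg := hf.comp₂ hg (· + ·)
  zero_mem' := IsLocallyConstant.const 0
  smul_mem' c f hf := hf.comp (c * ·)

/-- `D'(Ω)`: the algebraic dual of the space of locally constant functions on the boundary. -/
abbrev DualB := Module.Dual ℂ ↥(Clc G)

/-- Pairing of a functional on `C^lc(Ω)` with a function on the boundary. -/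
noncomputable def pairB (μ : DualB G) (g : Boundary G → ℂ) : ℂ :=
  if h : IsLocallyConstant g then μ ⟨g, h⟩ else 0

/-- The horocycle bracket `⟨x, ω⟩` with respect to the base point `o`: the unique integer `k`
such that `d(x, r n) = n - k` for every ray `r` from `o` representing `ω` and all large `n`. -/
noncomputable def horo (o x : X) (ω : Boundary G) : ℤ :=
  if h : ∃ k : ℤ, ∀ r : Ray G, Quot.mk (RayRel G) r = ω → r.1 0 = o →
      ∃ N : ℕ, ∀ n : ℕ, N ≤ n → (G.dist x (r.1 n) : ℤ) = (n : ℤ) - k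
  then h.choose else 0

/-- The scalar Poisson transform. -/
noncomputable def poisson (o : X) (z : ℂ) (μ : DualB G) (x : X) : ℂ :=
  pairB G μ fun ω => z ^ horo G o x ω

/-- The edge Poisson transform. -/
noncomputable def edgePoisson (o : X) (z : ℂ) (μ : DualB G) (e : DE G) : ℂ :=
  pairB G μ fun ω => z ^ horo G o (ini e) ω * Set.indicator (plusBd G e) 1 ω

/-! ## The shift space of non-backtracking chains of edges -/

/-- An infinite concatenated non-backtracking sequence of directed edges. -/
def IsChainSeq (c : ℕ → DE G) : Prop :=
  ∀ i, ter (c i) = ini (c (i + 1)) ∧ ter (c (i + 1)) ≠ ini (c i)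

/-- The shift space `𝔓`. -/
abbrev ChainSp := {c : ℕ → DE G // IsChainSeq G c}

/-- The one-sided shift on chains. -/
def shift (c : ChainSp G) : ChainSp G := ⟨fun n => c.1 (n + 1), fun i => c.2 (i + 1)⟩

/-- The district (cylinder) topology on the shift space. -/
instance : TopologicalSpace (ChainSp G) :=
  TopologicalSpace.generateFrom
    {s | ∃ (c₀ : ChainSp G) (n : ℕ), s = {c : ChainSp G | ∀ i ≤ n, c.1 i = c₀.1 i}}

/-- The Ruelle transfer operator. -/
noncomputable def transfer (F : ChainSp G → ℂ) (c : ChainSp G) : ℂ :=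
  ∑ᶠ c' ∈ {c' : ChainSp G | shift G c' = c}, F c'

/-- Functions on chains depending only on the first `N` edges. -/
def cylFun (N : ℕ) : Set (ChainSp G → ℂ) :=
  {F | ∀ c c' : ChainSp G, (∀ i < N, c.1 i = c'.1 i) → F c = F c'}

/-- The ray of initial vertices of a chain of edges. -/
def toRay (c : ChainSp G) : Ray G :=
  ⟨fun n => ini (c.1 n), by
    refine ⟨fun n => ?_, fun n => ?_⟩
    · have h1 : ter (c.1 n) = ini (c.1 (n + 1)) := (c.2 n).1
      have h2 : G.Adj (ini (c.1 n)) (ter (c.1 n)) := (c.1 n).2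
      rwa [h1] at h2
    · have h1 : ter (c.1 (n + 1)) = ini (c.1 (n + 2)) := (c.2 (n + 1)).1
      have h2 : ter (c.1 (n + 1)) ≠ ini (c.1 n) := (c.2 n).2
      rwa [h1] at h2⟩

/-- The endpoint map `B : 𝔓 → Ω`. -/
def endB (c : ChainSp G) : Boundary G := Quot.mk (RayRel G) (toRay G c)

/-- The pushforward `B_⋆` by fiber summation. -/
noncomputable def push (f : ChainSp G → ℂ) (ω : Boundary G) : ℂ :=
  ∑ᶠ c ∈ {c : ChainSp G | endB G c = ω}, f c

/-- The space of locally constant compactly supported functions on the shift space. -/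
noncomputable def CcP : Submodule ℂ (ChainSp G → ℂ) where
  carrier := {F | IsLocallyConstant F ∧ HasCompactSupport F}
  add_mem' hf hg := ⟨hf.1.comp₂ hg.1 (· + ·), hf.2.add hg.2⟩
  zero_mem' := ⟨IsLocallyConstant.const 0, HasCompactSupport.zero⟩
  smul_mem' c f hf := ⟨hf.1.comp (c * ·),
    hf.2.mono fun x hx h0 => hx (by simp [h0])⟩

/-- `D'(𝔓)`: the algebraic dual of `C^lc_c(𝔓)`. -/
abbrev DualP := Module.Dual ℂ ↥(CcP G)

/-- Pairing of a functional on `C^lc_c(𝔓)` with a function on the shift space. -/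
noncomputable def pairP (lam : DualP G) (g : ChainSp G → ℂ) : ℂ :=
  if h : g ∈ CcP G then lam ⟨g, h⟩ else 0

/-- The space of locally constant functions on the shift space (for finite graphs this is
`C^lc_c(𝔓)` since `𝔓` is compact). -/
noncomputable def ClcP : Submodule ℂ (ChainSp G → ℂ) where
  carrier := {F | IsLocallyConstant F}
  add_mem' hf hg := hf.comp₂ hg (· + ·)
  zero_mem' := IsLocallyConstant.const 0
  smul_mem' c f hf := hf.comp (c * ·)

/-- The dual of `C^lc(𝔓)`. -/
abbrev DualPc := Module.Dual ℂ ↥(ClcP G)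

/-- Pairing of a functional on `C^lc(𝔓)` with a function on the shift space. -/
noncomputable def pairPc (lam : DualPc G) (g : ChainSp G → ℂ) : ℂ :=
  if h : IsLocallyConstant g then lam ⟨g, h⟩ else 0

/-! ## Vertex Laplacian -/

/-- The vertex Laplacian (averaging over neighbors). -/
noncomputable def vertexLap (f : X → ℂ) (x : X) : ℂ :=
  ((deg G x : ℂ))⁻¹ * ∑ᶠ e ∈ {e : DE G | ini e = x}, f (ter e)

/-- The function `χ(z)(x) = (z + q_x z⁻¹)/(q_x + 1)`. -/
noncomputable def chi (z : ℂ) (x : X) : ℂ :=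
  (z + ((deg G x : ℂ) - 1) * z⁻¹) / (deg G x : ℂ)

/-- The `χ(z)`-eigenspace of the vertex Laplacian. -/
def vertexEig (z : ℂ) : Set (X → ℂ) := {f | ∀ x, vertexLap G f x = chi G z x * f x}

/-! ## Miscellaneous -/

/-- Two subsets of complex vector spaces (in practice: subspaces) are linearly isomorphic. -/
def AreLinIso {M N : Type} [AddCommMonoid M] [Module ℂ M] [AddCommMonoid N] [Module ℂ N]
    (A : Set M) (B : Set N) : Prop :=
  ∃ F : M → N, Set.BijOn F A B ∧ (∀ a ∈ A, ∀ b ∈ A, F (a + b) = F a + F b) ∧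
    ∀ (c : ℂ), ∀ a ∈ A, F (c • a) = c • F a

/-- The `z`-eigenspace of the edge Laplacian as a submodule (for a locally finite graph). -/
noncomputable def edgeEigSub (hlf : LocFin G) (z : ℂ) : Submodule ℂ (DE G → ℂ) where
  carrier := edgeEig G z
  add_mem' := by
    intro f g hf hg e
    have hS : {e' : DE G | ini e' = ter e ∧ e' ≠ op e}.Finite :=
      (hlf (ter e)).subset fun _ h => h.1
    have : edgeLap G (f + g) e = edgeLap G f e + edgeLap G g e := by
      simpa [edgeLap] using finsum_mem_add_distrib (f := f) (g := g) hS
    rw [this, hf e, hg e, Pi.add_apply, mul_add]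
  zero_mem' := by
    intro e
    simp [edgeLap]
  smul_mem' := by
    intro c f hf e
    have hS : {e' : DE G | ini e' = ter e ∧ e' ≠ op e}.Finite :=
      (hlf (ter e)).subset fun _ h => h.1
    have : edgeLap G (c • f) e = c * edgeLap G f e := by
      simp only [edgeLap, Pi.smul_apply, smul_eq_mul]
      rw [finsum_mem_eq_finite_toFinset_sum _ hS, finsum_mem_eq_finite_toFinset_sum _ hS,
        Finset.mul_sum]
    rw [Pi.smul_apply, smul_eq_mul, this, hf e]; ring

/-- The cyclomatic number of a finite graph, as an integer. -/
noncomputable def cyclo : ℤ := (Nat.card G.edgeSet : ℤ) - (Nat.card X : ℤ) + 1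

/-- 2-colorability. -/
def TwoColorable : Prop := ∃ col : X → Bool, ∀ x y : X, G.Adj x y → col x ≠ col y

/-! ## Rays in a tree -/

theorem adj_eq_of_dist_eq_add_one {G : SimpleGraph X} (hT : G.IsTree) {x u v w : X}
    (hu : G.Adj u v) (hw : G.Adj w v) (hdu : G.dist x v = G.dist x u + 1)
    (hdw : G.dist x v = G.dist x w + 1) : u = w := by
  obtain ⟨p, hp⟩ := hT.connected.exists_walk_length_eq_dist x u
  obtain ⟨q, hq⟩ := hT.connected.exists_walk_length_eq_dist x w
  have hp' : (p.concat hu).IsPath :=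
    SimpleGraph.Walk.isPath_of_length_eq_dist _ (by rw [SimpleGraph.Walk.length_concat, hp, hdu])
  have hq' : (q.concat hw).IsPath :=
    SimpleGraph.Walk.isPath_of_length_eq_dist _ (by rw [SimpleGraph.Walk.length_concat, hq, hdw])
  have h := congrArg (fun P : G.Path x v => P.1.penultimate)
    ((hT.isAcyclic.subsingleton_path x v).elim ⟨_, hp'⟩ ⟨_, hq'⟩)
  simpa using h

theorem IsRay.dist_add {G : SimpleGraph X} (hT : G.IsTree) {r : ℕ → X} (hr : IsRay G r) {x : X}
    {n : ℕ} (h : G.dist x (r (n + 1)) = G.dist x (r n) + 1) (k : ℕ) :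
    G.dist x (r (n + k)) = G.dist x (r n) + k ∧
      G.dist x (r (n + k + 1)) = G.dist x (r n) + k + 1 := by
  induction k with
  | zero => exact ⟨rfl, h⟩
  | succ k ih =>
    refine ⟨ih.2, ?_⟩
    rcases hT.dist_eq_dist_add_one_of_adj x (hr.1 (n + k + 1)) with h' | h'
    · exact absurd (adj_eq_of_dist_eq_add_one hT (hr.1 (n + k + 1)).symm (hr.1 (n + k)) h'
        (by omega)) (hr.2 (n + k))
    · change G.dist x (r (n + k + 1 + 1)) = _
      omega

theorem IsRay.dist_zero {G : SimpleGraph X} (hT : G.IsTree) {r : ℕ → X} (hr : IsRay G r) (n : ℕ) :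
    G.dist (r 0) (r n) = n := by
  have h1 : G.dist (r 0) (r 1) = 1 := SimpleGraph.dist_eq_one_iff_adj.2 (hr.1 0)
  have := (hr.dist_add hT (x := r 0) (n := 0) (by simpa using h1) n).1
  simpa using this

theorem IsRay.injective {G : SimpleGraph X} (hT : G.IsTree) {r : ℕ → X} (hr : IsRay G r) :
    Injective r := fun m n h => by
  rw [← hr.dist_zero hT m, ← hr.dist_zero hT n, h]

theorem IsRay.eq_of_infinite {G : SimpleGraph X} (hT : G.IsTree) {r s : ℕ → X} (hr : IsRay G r)
    (hs : IsRay G s) (h0 : r 0 = s 0) (h : ∀ N, ∃ n ≥ N, r n = s n) : r = s := by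
  have key : ∀ n, r n = s n → ∀ m ≤ n, r m = s m := by
    intro n
    induction n with
    | zero => intro _ m hm; rwa [Nat.le_zero.1 hm]
    | succ n ih =>
      intro hn m hm
      rcases hm.lt_or_eq with hm | rfl
      · refine ih ?_ m (Nat.lt_succ_iff.1 hm)
        refine adj_eq_of_dist_eq_add_one hT (x := r 0) (hr.1 n) (hn ▸ hs.1 n) ?_ ?_
        · rw [hr.dist_zero hT, hr.dist_zero hT]
        · rw [hr.dist_zero hT, h0, hs.dist_zero hT]
      · exact hn
  funext m
  obtain ⟨n, hn, h⟩ := h m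
  exact key n h m hn

/-- Two sequences of vertices agree up to an index shift from some point on. -/
def TailEq (r s : ℕ → X) : Prop := ∃ m n, ∀ k, r (m + k) = s (n + k)

theorem TailEq.refl (r : ℕ → X) : TailEq r r := ⟨0, 0, fun _ => rfl⟩

theorem TailEq.symm {r s : ℕ → X} : TailEq r s → TailEq s r :=
  fun ⟨m, n, h⟩ => ⟨n, m, fun k => (h k).symm⟩

theorem TailEq.trans {r s t : ℕ → X} : TailEq r s → TailEq s t → TailEq r t := by
  rintro ⟨m, n, h⟩ ⟨m', n', h'⟩
  refine ⟨m + m', n' + n, fun k => ?_⟩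
  rw [add_assoc, h, add_assoc, ← h', ← add_assoc, ← add_assoc, add_comm n]

theorem TailEq.rayRel {G : SimpleGraph X} (hT : G.IsTree) {r s : Ray G} (h : TailEq r.1 s.1) :
    RayRel G r s := by
  obtain ⟨m, n, h⟩ := h
  refine (Set.infinite_range_of_injective (f := fun k => r.1 (m + k)) fun a b hab => ?_).mono ?_
  · exact Nat.add_left_cancel (r.2.injective hT hab)
  · rintro _ ⟨k, rfl⟩
    exact ⟨⟨_, rfl⟩, ⟨n + k, (h k).symm⟩⟩

theorem IsRay.eq_of_tailEq {G : SimpleGraph X} (hT : G.IsTree) {r s : ℕ → X} (hr : IsRay G r)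
    (hs : IsRay G s) (h0 : r 0 = s 0) (h : TailEq r s) : r = s := by
  obtain ⟨m, n, h⟩ := h
  have hmn : m = n := by
    have := h 0
    simp only [add_zero] at this
    rw [← hr.dist_zero hT m, ← hs.dist_zero hT n, h0, this]
  subst hmn
  exact hr.eq_of_infinite hT hs h0 fun N => ⟨m + N, by omega, h N⟩

theorem IsRay.shift {G : SimpleGraph X} {r : ℕ → X} (hr : IsRay G r) :
    IsRay G fun n => r (n + 1) :=
  ⟨fun n => hr.1 (n + 1), fun n => hr.2 (n + 1)⟩

theorem IsRay.cons {G : SimpleGraph X} {r : ℕ → X} (hr : IsRay G r) {y : X} (hy : G.Adj y (r 0))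
    (hne : r 1 ≠ y) : IsRay G fun n => Nat.casesOn n y r := by
  refine ⟨fun n => ?_, fun n => ?_⟩
  · cases n with
    | zero => exact hy
    | succ n => exact hr.1 n
  · cases n with
    | zero => exact hne
    | succ n => exact hr.2 n

/-- A ray can be moved to start at any given vertex. -/
theorem exists_ray_from {G : SimpleGraph X} (hT : G.IsTree) (r : Ray G) (x : X) :
    ∃ s : Ray G, s.1 0 = x ∧ TailEq s.1 r.1 := by
  obtain ⟨p⟩ := hT.connected.preconnected x (r.1 0)
  generalize hv : r.1 0 = v at p
  induction p generalizing r with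
  | nil => exact ⟨r, hv, TailEq.refl _⟩
  | @cons u v w huv p ih =>
    obtain ⟨s, hs0, hs⟩ := ih r hv
    by_cases h1 : s.1 1 = u
    · exact ⟨⟨_, s.2.shift⟩, h1, TailEq.trans ⟨0, 1, fun k => by simp [add_comm]⟩ hs⟩
    · refine ⟨⟨_, s.2.cons (y := u) (by rwa [hs0]) h1⟩, rfl, TailEq.trans ⟨1, 0, fun k => ?_⟩ hs⟩
      simp [add_comm 1 k]

theorem RayRel.tailEq {G : SimpleGraph X} (hT : G.IsTree) {r s : Ray G} (h : RayRel G r s) :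
    TailEq r.1 s.1 := by
  obtain ⟨t, ht0, hts⟩ := exists_ray_from hT s (r.1 0)
  refine TailEq.trans ?_ hts
  suffices r.1 = t.1 from this ▸ TailEq.refl _
  refine r.2.eq_of_infinite hT t.2 ht0.symm fun N => ?_
  obtain ⟨m, n, hmn⟩ := hts
  have hfin : (r.1 '' Set.Iio (N + m) ∪ s.1 '' Set.Iio (n + N)).Finite :=
    ((Set.finite_Iio _).image _).union ((Set.finite_Iio _).image _)
  obtain ⟨_, ⟨⟨a, rfl⟩, ⟨b, hb⟩⟩, hv⟩ := (h.sdiff hfin).nonempty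
  simp only [Set.mem_union, not_or] at hv
  have ha : N + m ≤ a := by
    by_contra hlt
    exact hv.1 ⟨a, not_le.1 hlt, rfl⟩
  have hbn : n + N ≤ b := by
    by_contra hlt
    exact hv.2 ⟨b, not_le.1 hlt, hb⟩
  have hb' : r.1 a = t.1 (m + (b - n)) := by
    rw [hmn, ← hb, Nat.add_sub_cancel' (by omega : n ≤ b)]
  have : a = m + (b - n) := by
    rw [← r.2.dist_zero hT a, ← t.2.dist_zero hT (m + (b - n)), ht0, hb']
  exact ⟨a, by lia, by rw [hb', ← this]⟩

theorem mk_eq_mk_iff {G : SimpleGraph X} (hT : G.IsTree) {r s : Ray G} :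
    Quot.mk (RayRel G) r = Quot.mk (RayRel G) s ↔ TailEq r.1 s.1 := by
  refine ⟨fun h => ?_, fun h => Quot.sound (h.rayRel hT)⟩
  have hgen := Quot.eqvGen_exact h
  clear h
  induction hgen with
  | rel _ _ h => exact RayRel.tailEq hT h
  | refl _ => exact TailEq.refl _
  | symm _ _ _ ih => exact ih.symm
  | trans _ _ _ _ _ ih ihs => exact ih.trans ihs

/-! ## Chains of edges as pairs of an initial vertex and an end point -/

/-- The chain of edges traversed by a ray. -/
def chainOfRay {G : SimpleGraph X} (r : Ray G) : ChainSp G :=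
  ⟨fun n => ⟨(r.1 n, r.1 (n + 1)), r.2.1 n⟩, fun n => ⟨rfl, r.2.2 n⟩⟩

theorem chainOfRay_toRay {G : SimpleGraph X} (c : ChainSp G) : chainOfRay (toRay G c) = c := by
  refine Subtype.ext (funext fun n => Subtype.ext (Prod.ext rfl ?_))
  exact (c.2 n).1.symm

theorem endB_shift {G : SimpleGraph X} (hT : G.IsTree) (c : ChainSp G) :
    endB G (shift G c) = endB G c :=
  (mk_eq_mk_iff hT).2 ⟨0, 1, fun k => by simp [toRay, shift, add_comm 1 k]⟩

theorem chain_ext {G : SimpleGraph X} (hT : G.IsTree) {c c' : ChainSp G}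
    (h0 : ini (c.1 0) = ini (c'.1 0)) (hB : endB G c = endB G c') : c = c' := by
  rw [← chainOfRay_toRay c, ← chainOfRay_toRay c']
  congr 1
  exact Subtype.ext ((toRay G c).2.eq_of_tailEq hT (toRay G c').2 h0 ((mk_eq_mk_iff hT).1 hB))

theorem exists_chain {G : SimpleGraph X} (hT : G.IsTree) (x : X) (ω : Boundary G) :
    ∃ c : ChainSp G, ini (c.1 0) = x ∧ endB G c = ω := by
  induction ω using Quot.ind with
  | mk r =>
    obtain ⟨s, hs0, hs⟩ := exists_ray_from hT r x
    exact ⟨chainOfRay s, hs0, (mk_eq_mk_iff hT).2 hs⟩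

/-- The chain from a vertex to a boundary point. -/
noncomputable def chainTo {G : SimpleGraph X} (hT : G.IsTree) (x : X) (ω : Boundary G) :
    ChainSp G :=
  (exists_chain hT x ω).choose

section chainTo

variable {G : SimpleGraph X} (hT : G.IsTree)

@[simp]
theorem ini_chainTo (x : X) (ω : Boundary G) : ini ((chainTo hT x ω).1 0) = x :=
  (exists_chain hT x ω).choose_spec.1

@[simp]
theorem endB_chainTo (x : X) (ω : Boundary G) : endB G (chainTo hT x ω) = ω :=
  (exists_chain hT x ω).choose_spec.2

@[simp]
theorem chainTo_endB (c : ChainSp G) : chainTo hT (ini (c.1 0)) (endB G c) = c :=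
  chain_ext hT (by simp) (by simp)

theorem shift_chainTo (x : X) (ω : Boundary G) :
    shift G (chainTo hT x ω) = chainTo hT (ter ((chainTo hT x ω).1 0)) ω := by
  refine chain_ext hT ?_ (by rw [endB_shift hT, endB_chainTo, endB_chainTo])
  rw [ini_chainTo]
  exact ((chainTo hT x ω).2 0).1.symm

theorem mem_plusBd_iff (e : DE G) (ω : Boundary G) :
    ω ∈ plusBd G e ↔ (chainTo hT (ini e) ω).1 0 = e := by
  constructor
  · rintro ⟨r, rfl, h0, h1⟩
    have : chainTo hT (ini e) (Quot.mk _ r) = chainOfRay r :=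
      chain_ext hT ((ini_chainTo hT _ _).trans h0.symm) (endB_chainTo hT _ _)
    rw [this]
    exact Subtype.ext (Prod.ext h0 h1)
  · intro h
    refine ⟨toRay G (chainTo hT (ini e) ω), endB_chainTo hT _ _, ini_chainTo hT _ _, ?_⟩
    conv_rhs => rw [← h]
    exact ((chainTo hT (ini e) ω).2 0).1.symm

end chainTo

theorem compl_plusBd {G : SimpleGraph X} (hT : G.IsTree) (e : DE G) : (plusBd G e)ᶜ = plusBd G (op e) := by
  ext ω
  rw [Set.mem_compl_iff, mem_plusBd_iff hT, mem_plusBd_iff hT]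
  change _ ↔ (chainTo hT (ter e) ω).1 0 = op e
  constructor
  · intro h
    have hr : IsRay G fun n => Nat.casesOn n (ter e) (toRay G (chainTo hT (ini e) ω)).1 := by
      refine (toRay G (chainTo hT (ini e) ω)).2.cons ?_ fun h' => h ?_
      · have h0 : (toRay G (chainTo hT (ini e) ω)).1 0 = ini e := ini_chainTo hT _ _
        rw [h0]
        exact e.2.symm
      · refine Subtype.ext (Prod.ext (ini_chainTo hT _ _) ?_)
        exact ((chainTo hT (ini e) ω).2 0).1.trans h'
    have : chainTo hT (ter e) ω = chainOfRay ⟨_, hr⟩ := by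
      refine chain_ext hT (ini_chainTo hT _ _) ?_
      rw [← endB_shift hT (chainOfRay _), endB_chainTo]
      exact (endB_chainTo hT (ini e) ω).symm
    rw [this]
    exact Subtype.ext (Prod.ext rfl (ini_chainTo hT _ _))
  · intro h h'
    have h1 := shift_chainTo hT (ini e) ω
    rw [h'] at h1
    have h2 : (chainTo hT (ini e) ω).1 1 = op e := (congrArg (fun c => c.1 0) h1).trans h
    have h3 := ((chainTo hT (ini e) ω).2 0).2
    rw [zero_add, h2, h'] at h3
    exact h3 rfl

/-! ## The horocycle bracket -/

theorem horo_eq {G : SimpleGraph X} (hT : G.IsTree) (o : X) (c : ChainSp G) {m n : ℕ}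
    (h : ∀ k, (toRay G (chainTo hT o (endB G c))).1 (m + k) = (toRay G c).1 (n + k)) :
    horo G o (ini (c.1 0)) (endB G c) = (m : ℤ) - n := by
  have hc : Quot.mk (RayRel G) (toRay G (chainTo hT o (endB G c))) = endB G c := endB_chainTo hT _ _
  have key : ∀ r : Ray G, Quot.mk (RayRel G) r = endB G c → r.1 0 = o →
      ∀ j : ℕ, m ≤ j → (G.dist (ini (c.1 0)) (r.1 j) : ℤ) = (j : ℤ) - (m - n) := by
    intro r hr hr0 j hj
    have hrc : r = toRay G (chainTo hT o (endB G c)) :=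
      Subtype.ext (r.2.eq_of_tailEq hT (Subtype.prop _)
        (hr0.trans (ini_chainTo hT o _).symm) ((mk_eq_mk_iff hT).1 (hr.trans hc.symm)))
    obtain ⟨k, rfl⟩ := Nat.exists_eq_add_of_le hj
    rw [hrc, h k]
    have := (toRay G c).2.dist_zero hT (n + k)
    change G.dist (ini (c.1 0)) _ = _ at this
    rw [this]
    push_cast
    ring
  have hex : ∃ k : ℤ, ∀ r : Ray G, Quot.mk (RayRel G) r = endB G c → r.1 0 = o →
      ∃ N : ℕ, ∀ n : ℕ, N ≤ n → (G.dist (ini (c.1 0)) (r.1 n) : ℤ) = (n : ℤ) - k :=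
    ⟨m - n, fun r hr hr0 => ⟨m, key r hr hr0⟩⟩
  rw [horo, dif_pos hex]
  obtain ⟨N, hN⟩ := hex.choose_spec _ hc (ini_chainTo hT o _)
  have h1 := hN (max N m) (le_max_left _ _)
  have h2 := key _ hc (ini_chainTo hT o _) (max N m) (le_max_right _ _)
  linarith

theorem horo_self {G : SimpleGraph X} (hT : G.IsTree) (o : X) (ω : Boundary G) :
    horo G o o ω = 0 := by
  have := horo_eq hT o (chainTo hT o ω) (m := 0) (n := 0) fun k => by rw [endB_chainTo]
  simpa using this

theorem horo_ter {G : SimpleGraph X} (hT : G.IsTree) (o : X) (c : ChainSp G) :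
    horo G o (ter (c.1 0)) (endB G c) = horo G o (ini (c.1 0)) (endB G c) + 1 := by
  have hB : Quot.mk (RayRel G) (toRay G (chainTo hT o (endB G c))) =
      Quot.mk (RayRel G) (toRay G c) := endB_chainTo hT _ _
  obtain ⟨m, n, h⟩ := (mk_eq_mk_iff hT).1 hB
  have h1 := horo_eq hT o c h
  have h2 := horo_eq hT o (shift G c) (m := m + 1) (n := n) fun k => by
    rw [endB_shift hT, add_assoc, h]
    exact congrArg (fun j => ini (c.1 j)) (by omega)
  rw [endB_shift hT] at h2
  rw [(c.2 0).1, h1]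
  refine h2.trans ?_
  push_cast
  ring

theorem horo_ter_of_mem {G : SimpleGraph X} (hT : G.IsTree) (o : X) {e : DE G} {ω : Boundary G}
    (h : ω ∈ plusBd G e) : horo G o (ter e) ω = horo G o (ini e) ω + 1 := by
  have key := horo_ter hT o (chainTo hT (ini e) ω)
  rwa [(mem_plusBd_iff hT e ω).1 h, endB_chainTo] at key

/-! ## Topology of the shift space and of the boundary -/

theorem isOpen_coord (G : SimpleGraph X) (i : ℕ) (S : Set (DE G)) :
    IsOpen {c : ChainSp G | c.1 i ∈ S} := by
  rw [isOpen_iff_mem_nhds]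
  intro c hc
  have hU : IsOpen {c' : ChainSp G | ∀ j ≤ i, c'.1 j = c.1 j} :=
    TopologicalSpace.isOpen_generateFrom_of_mem ⟨c, i, rfl⟩
  refine Filter.mem_of_superset (hU.mem_nhds fun _ _ => rfl) fun c' hc' => ?_
  change c'.1 i ∈ S
  rw [hc' i le_rfl]
  exact hc

theorem isOpen_ini (G : SimpleGraph X) (i : ℕ) (S : Set X) :
    IsOpen {c : ChainSp G | ini (c.1 i) ∈ S} :=
  isOpen_coord G i {e | ini e ∈ S}

theorem isOpen_ini_pair (G : SimpleGraph X) (i j : ℕ) (R : X → X → Prop) :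
    IsOpen {c : ChainSp G | R (ini (c.1 i)) (ini (c.1 j))} := by
  have : {c : ChainSp G | R (ini (c.1 i)) (ini (c.1 j))} =
      ⋃ u, {c | ini (c.1 i) ∈ ({u} : Set X)} ∩ {c | ini (c.1 j) ∈ {v | R u v}} := by
    ext c
    simp
  rw [this]
  exact isOpen_iUnion fun u => (isOpen_ini G i {u}).inter (isOpen_ini G j _)

theorem isOpen_plusBd (e : DE G) : IsOpen (plusBd G e) :=
  TopologicalSpace.isOpen_generateFrom_of_mem ⟨e, rfl⟩

theorem isClopen_plusBd {G : SimpleGraph X} (hT : G.IsTree) (e : DE G) :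
    IsClopen (plusBd G e) :=
  ⟨isOpen_compl_iff.1 (compl_plusBd hT e ▸ isOpen_plusBd G (op e)), isOpen_plusBd G e⟩

theorem exists_dist_of_endB_mem_plusBd {G : SimpleGraph X} (hT : G.IsTree) {e : DE G}
    {c : ChainSp G} (h : endB G c ∈ plusBd G e) :
    ∃ k, G.dist (ini e) (ini (c.1 (k + 1))) = G.dist (ini e) (ini (c.1 k)) + 1 ∧
      G.dist (ter e) (ini (c.1 (k + 1))) = G.dist (ter e) (ini (c.1 k)) + 1 ∧
      G.dist (ini e) (ini (c.1 k)) = G.dist (ter e) (ini (c.1 k)) + 1 := by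
  obtain ⟨r, hr, h0, h1⟩ := h
  obtain ⟨m, n, hmn⟩ := (mk_eq_mk_iff hT).1 (hr : _ = Quot.mk (RayRel G) (toRay G c))
  have hc : ∀ j, ini (c.1 (n + j)) = r.1 (m + j) := fun j => (hmn j).symm
  have d0 : ∀ j, G.dist (ini e) (r.1 j) = j := fun j => h0 ▸ r.2.dist_zero hT j
  have d1 : ∀ j, G.dist (ter e) (r.1 (j + 1)) = j := fun j => h1 ▸ r.2.shift.dist_zero hT j
  refine ⟨n + 1, ?_⟩
  rw [add_assoc, hc, hc, d0, d0, show m + (1 + 1) = m + 1 + 1 by omega, d1, d1]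
  omega

/-- A boundary point lies beyond the edge `e` as soon as some segment of a chain towards it moves
away from both end points of `e` and is closer to the terminal one. -/
theorem endB_mem_plusBd_of_dist {G : SimpleGraph X} (hT : G.IsTree) {e : DE G} {c : ChainSp G}
    {k : ℕ} (h1 : G.dist (ini e) (ini (c.1 (k + 1))) = G.dist (ini e) (ini (c.1 k)) + 1)
    (h2 : G.dist (ter e) (ini (c.1 (k + 1))) = G.dist (ter e) (ini (c.1 k)) + 1)
    (h3 : G.dist (ini e) (ini (c.1 k)) = G.dist (ter e) (ini (c.1 k)) + 1) :
    endB G c ∈ plusBd G e := by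
  by_contra h
  rw [← Set.mem_compl_iff, compl_plusBd hT] at h
  obtain ⟨l, k1, k2, k3⟩ := exists_dist_of_endB_mem_plusBd hT h
  have hr := (toRay G c).2
  have e1 := (hr.dist_add hT h1 l).1
  have e2 := (hr.dist_add hT h2 l).1
  have e3 := (hr.dist_add hT k1 k).1
  have e4 := (hr.dist_add hT k2 k).1
  rw [add_comm l k] at e3 e4
  simp only [toRay, show ini (op e) = ter e from rfl, show ter (op e) = ini e from rfl]
    at e1 e2 e3 e4 k3
  omega

theorem continuous_endB {G : SimpleGraph X} (hT : G.IsTree) : Continuous (endB G) := by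
  refine continuous_generateFrom_iff.2 ?_
  rintro _ ⟨e, rfl⟩
  have : endB G ⁻¹' plusBd G e = ⋃ k, {c : ChainSp G |
      G.dist (ini e) (ini (c.1 (k + 1))) = G.dist (ini e) (ini (c.1 k)) + 1 ∧
      G.dist (ter e) (ini (c.1 (k + 1))) = G.dist (ter e) (ini (c.1 k)) + 1 ∧
      G.dist (ini e) (ini (c.1 k)) = G.dist (ter e) (ini (c.1 k)) + 1} := by
    ext c
    rw [Set.mem_iUnion]
    exact ⟨exists_dist_of_endB_mem_plusBd hT,
      fun ⟨k, h1, h2, h3⟩ => endB_mem_plusBd_of_dist hT h1 h2 h3⟩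
  rw [this]
  exact isOpen_iUnion fun k => isOpen_ini_pair G k (k + 1)
    fun u v => G.dist (ini e) v = G.dist (ini e) u + 1 ∧
      G.dist (ter e) v = G.dist (ter e) u + 1 ∧ G.dist (ini e) u = G.dist (ter e) u + 1

theorem isOpen_chainTo_coord {G : SimpleGraph X} (hT : G.IsTree) (i : ℕ) (x : X) (e : DE G) :
    IsOpen {ω | (chainTo hT x ω).1 i = e} := by
  induction i generalizing x with
  | zero =>
    by_cases hx : ini e = x
    · subst hx
      convert isOpen_plusBd G e using 1
      ext ω
      exact (mem_plusBd_iff hT e ω).symm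
    · convert isOpen_empty
      ext ω
      refine iff_of_false (fun h => hx ?_) id
      rw [← h, ini_chainTo]
  | succ i ih =>
    have : {ω | (chainTo hT x ω).1 (i + 1) = e} = ⋃ e' : {e' : DE G // ini e' = x},
        plusBd G e'.1 ∩ {ω | (chainTo hT (ter e'.1) ω).1 i = e} := by
      ext ω
      simp only [Set.mem_iUnion, Set.mem_inter_iff]
      have hs := congrArg (fun c => c.1 i) (shift_chainTo hT x ω)
      change (chainTo hT x ω).1 (i + 1) = _ at hs
      constructor
      · intro h
        refine ⟨⟨(chainTo hT x ω).1 0, ini_chainTo hT x ω⟩, ?_, hs.symm.trans h⟩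
        rw [mem_plusBd_iff hT, ini_chainTo]
      · rintro ⟨⟨e', rfl⟩, h1, h2⟩
        rw [mem_plusBd_iff hT] at h1
        rw [h1] at hs
        exact hs.trans h2
    rw [this]
    exact isOpen_iUnion fun e' => (isOpen_plusBd G e'.1).inter (ih _)

theorem continuous_chainTo {G : SimpleGraph X} (hT : G.IsTree) (x : X) :
    Continuous (chainTo hT x) := by
  refine continuous_generateFrom_iff.2 ?_
  rintro _ ⟨c₀, n, rfl⟩
  have : chainTo hT x ⁻¹' {c | ∀ i ≤ n, c.1 i = c₀.1 i} =
      ⋂ i ∈ Set.Iic n, {ω | (chainTo hT x ω).1 i = c₀.1 i} := by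
    ext ω
    simp
  rw [this]
  exact (Set.finite_Iic n).isOpen_biInter fun i _ => isOpen_chainTo_coord hT i x _

/-- The edges that chains starting at `x` can reach after `i` steps. -/
def reachSet (G : SimpleGraph X) (x : X) : ℕ → Set (DE G)
  | 0 => {e | ini e = x}
  | i + 1 => ⋃ e ∈ reachSet G x i, {e' | ini e' = ter e}

theorem finite_reachSet {G : SimpleGraph X} (hlf : LocFin G) (x : X) (i : ℕ) :
    (reachSet G x i).Finite := by
  induction i with
  | zero => exact hlf x
  | succ i ih => exact ih.biUnion fun e _ => hlf (ter e)

theorem mem_reachSet {G : SimpleGraph X} (c : ChainSp G) (i : ℕ) :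
    c.1 i ∈ reachSet G (ini (c.1 0)) i := by
  induction i with
  | zero => rfl
  | succ i ih => exact Set.mem_biUnion ih (c.2 i).1.symm

theorem isCompact_chains_from {G : SimpleGraph X} (hlf : LocFin G) (x : X) :
    IsCompact {c : ChainSp G | ini (c.1 0) = x} := by
  let : TopologicalSpace (DE G) := ⊥
  have : DiscreteTopology (DE G) := ⟨rfl⟩
  let Q : Set (ℕ → DE G) := {f | IsChainSeq G f ∧ ini (f 0) = x}
  have hclosed : IsClosed Q := by
    have : Q = (⋂ i, {f : ℕ → DE G | (f i, f (i + 1)) ∈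
        {p : DE G × DE G | ter p.1 = ini p.2 ∧ ter p.2 ≠ ini p.1}}) ∩
          {f | f 0 ∈ {e : DE G | ini e = x}} := by
      ext f
      simp [Q, IsChainSeq]
    rw [this]
    exact (isClosed_iInter fun i => (isClosed_discrete _).preimage
      ((continuous_apply i).prodMk (continuous_apply (i + 1)))).inter
        ((isClosed_discrete _).preimage (continuous_apply 0))
  have hQ : IsCompact Q := by
    refine (isCompact_univ_pi fun i => (finite_reachSet hlf x i).isCompact).of_isClosed_subset
      hclosed ?_
    rintro f ⟨hf, rfl⟩ i -
    exact mem_reachSet ⟨f, hf⟩ i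
  have : CompactSpace Q := isCompact_iff_compactSpace.1 hQ
  have hcont : Continuous fun q : Q => (⟨q.1, q.2.1⟩ : ChainSp G) := by
    refine continuous_generateFrom_iff.2 ?_
    rintro _ ⟨c₀, n, rfl⟩
    have : (fun q : Q => (⟨q.1, q.2.1⟩ : ChainSp G)) ⁻¹' {c | ∀ i ≤ n, c.1 i = c₀.1 i} =
        ⋂ i ∈ Set.Iic n, {q : Q | q.1 i ∈ ({c₀.1 i} : Set (DE G))} := by
      ext q
      simp
    rw [this]
    exact (Set.finite_Iic n).isOpen_biInter fun i _ => (isOpen_discrete _).preimage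
      ((continuous_apply i).comp continuous_subtype_val)
  convert isCompact_range hcont using 1
  ext c
  constructor
  · intro h
    exact ⟨⟨c.1, c.2, h⟩, rfl⟩
  · rintro ⟨q, rfl⟩
    exact q.2.2

theorem mem_CcP_iff {G : SimpleGraph X} (hT : G.IsTree) (hlf : LocFin G) {f : ChainSp G → ℂ} :
    f ∈ CcP G ↔ (∀ x, IsLocallyConstant fun ω => f (chainTo hT x ω)) ∧
      {x | ∃ ω, f (chainTo hT x ω) ≠ 0}.Finite := by
  constructor
  · rintro ⟨hf, hK⟩
    refine ⟨fun x => hf.comp_continuous (continuous_chainTo hT x), ?_⟩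
    obtain ⟨t, ht⟩ := IsCompact.elim_finite_subcover hK
      (fun x : X => {c : ChainSp G | ini (c.1 0) ∈ ({x} : Set X)}) (fun x => isOpen_ini G 0 {x})
      fun c _ => Set.mem_iUnion.2 ⟨_, rfl⟩
    refine t.finite_toSet.subset ?_
    rintro x ⟨ω, hω⟩
    obtain ⟨y, hy, h⟩ := Set.mem_iUnion₂.1 (ht (subset_tsupport f hω))
    have hxy : x = y := (ini_chainTo hT x ω).symm.trans h
    exact hxy ▸ hy
  · rintro ⟨hf, hF⟩
    refine ⟨fun s => ?_, ?_⟩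
    · have : f ⁻¹' s = ⋃ x, {c | ini (c.1 0) ∈ ({x} : Set X)} ∩
          endB G ⁻¹' ((fun ω => f (chainTo hT x ω)) ⁻¹' s) := by
        ext c
        simp
      rw [this]
      exact isOpen_iUnion fun x => (isOpen_ini G 0 {x}).inter
        ((hf x s).preimage (continuous_endB hT))
    · refine HasCompactSupport.intro'
        (K := ⋃ x ∈ {x | ∃ ω, f (chainTo hT x ω) ≠ 0}, {c : ChainSp G | ini (c.1 0) = x})
        (hF.isCompact_biUnion fun x _ => isCompact_chains_from hlf x)
        (hF.isClosed_biUnion fun x _ => ?_) fun c hc => ?_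
      · exact isOpen_compl_iff.1 (isOpen_ini G 0 {x}ᶜ)
      · by_contra h
        exact hc (Set.mem_biUnion (x := ini (c.1 0)) ⟨endB G c, by rwa [chainTo_endB]⟩ rfl)

/-! ## Transfer operator, pushforward and weights in coordinates -/

theorem isLocallyConstant_ite_mem {Y Z : Type*} [TopologicalSpace Y] {U : Set Y} (hU : IsClopen U)
    {f g : Y → Z} (hf : IsLocallyConstant f) (hg : IsLocallyConstant g) :
    IsLocallyConstant fun y => if y ∈ U then f y else g y := by
  intro s
  have : (fun y => if y ∈ U then f y else g y) ⁻¹' s = U ∩ f ⁻¹' s ∪ Uᶜ ∩ g ⁻¹' s := by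
    ext y
    by_cases hy : y ∈ U <;> simp [hy]
  rw [this]
  exact (hU.isOpen.inter (hf s)).union (hU.compl.isOpen.inter (hg s))

theorem chainTo_left_injective {G : SimpleGraph X} (hT : G.IsTree) (ω : Boundary G) :
    Injective fun x => chainTo hT x ω := fun x y h => by
  rw [← ini_chainTo hT x ω, ← ini_chainTo hT y ω]
  exact congrArg (fun c => ini (c.1 0)) h

theorem push_eq_finsum {G : SimpleGraph X} (hT : G.IsTree) (f : ChainSp G → ℂ) (ω : Boundary G) :
    push G f ω = ∑ᶠ x, f (chainTo hT x ω) := by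
  have : {c : ChainSp G | endB G c = ω} = Set.range fun x => chainTo hT x ω := by
    ext c
    constructor
    · rintro rfl
      exact ⟨_, chainTo_endB hT c⟩
    · rintro ⟨x, rfl⟩
      exact endB_chainTo hT x ω
  rw [push, this, finsum_mem_range (chainTo_left_injective hT ω)]

theorem push_eq_sum {G : SimpleGraph X} (hT : G.IsTree) {f : ChainSp G → ℂ} {F : Finset X}
    (hF : ∀ x ∉ F, ∀ ω, f (chainTo hT x ω) = 0) (ω : Boundary G) :
    push G f ω = ∑ x ∈ F, f (chainTo hT x ω) := by
  rw [push_eq_finsum hT]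
  refine finsum_eq_sum_of_support_subset _ fun x hx => ?_
  by_contra h
  exact hx (hF x h ω)

theorem transfer_eq_sum {G : SimpleGraph X} (hT : G.IsTree) {f : ChainSp G → ℂ} {F : Finset X}
    (hF : ∀ x ∉ F, ∀ ω, f (chainTo hT x ω) = 0) (x : X) (ω : Boundary G) :
    transfer G f (chainTo hT x ω) =
      ∑ y ∈ F, if ter ((chainTo hT y ω).1 0) = x then f (chainTo hT y ω) else 0 := by
  have : {c : ChainSp G | shift G c = chainTo hT x ω} =
      (fun y => chainTo hT y ω) '' {y | ter ((chainTo hT y ω).1 0) = x} := by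
    ext c
    constructor
    · intro h
      have hB : endB G c = ω := by
        rw [← endB_shift hT, show shift G c = _ from h, endB_chainTo]
      subst hB
      refine ⟨_, ?_, chainTo_endB hT c⟩
      rw [Set.mem_ofPred_eq, chainTo_endB, (c.2 0).1]
      exact (congrArg (fun c => ini (c.1 0)) h).trans (ini_chainTo hT _ _)
    · rintro ⟨y, rfl, rfl⟩
      exact shift_chainTo hT y ω
  rw [transfer, this, finsum_mem_image (chainTo_left_injective hT ω).injOn, finsum_mem_def]
  simp only [Set.indicator_apply, Set.mem_ofPred_eq]
  refine finsum_eq_sum_of_support_subset _ fun y hy => ?_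
  by_contra h
  exact hy (by simp [hF y h ω])

theorem exists_finset_support {G : SimpleGraph X} (hT : G.IsTree) (hlf : LocFin G)
    {f : ChainSp G → ℂ} (hf : f ∈ CcP G) :
    ∃ F : Finset X, ∀ x ∉ F, ∀ ω, f (chainTo hT x ω) = 0 := by
  refine ⟨((mem_CcP_iff hT hlf).1 hf).2.toFinset, fun x hx ω => ?_⟩
  by_contra h
  exact hx ((Set.Finite.mem_toFinset _).2 ⟨ω, h⟩)

theorem isLocallyConstant_chainTo_zero {G : SimpleGraph X} (hT : G.IsTree) (x : X) :
    IsLocallyConstant fun ω => (chainTo hT x ω).1 0 :=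
  IsLocallyConstant.iff_isOpen_fiber.2 fun e => isOpen_chainTo_coord hT 0 x e

theorem isLocallyConstant_sum (G : SimpleGraph X) {ι : Type*} (F : Finset ι)
    {f : ι → Boundary G → ℂ} (hf : ∀ i ∈ F, IsLocallyConstant (f i)) :
    IsLocallyConstant fun ω => ∑ i ∈ F, f i ω := by
  have := (Clc G).sum_mem hf
  rwa [Finset.sum_fn] at this

theorem transfer_mem_CcP {G : SimpleGraph X} (hT : G.IsTree) (hlf : LocFin G)
    {f : ChainSp G → ℂ} (hf : f ∈ CcP G) : transfer G f ∈ CcP G := by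
  obtain ⟨F, hF⟩ := exists_finset_support hT hlf hf
  rw [mem_CcP_iff hT hlf]
  constructor
  · intro x
    simp only [transfer_eq_sum hT hF]
    exact isLocallyConstant_sum G F fun y _ => isLocallyConstant_ite_mem
      (((isLocallyConstant_chainTo_zero hT y).comp ter).isClopen_fiber x)
      (((mem_CcP_iff hT hlf).1 hf).1 y) (IsLocallyConstant.const 0)
  · refine (F.finite_toSet.biUnion fun y _ => (hlf y).image ter).subset ?_
    rintro x ⟨ω, hω⟩
    rw [transfer_eq_sum hT hF] at hω
    obtain ⟨y, hy, h⟩ := Finset.exists_ne_zero_of_sum_ne_zero hω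
    exact Set.mem_biUnion hy ⟨_, ini_chainTo hT y ω, (ite_ne_right_iff.1 h).1⟩

theorem isLocallyConstant_horo {G : SimpleGraph X} (hT : G.IsTree) (o x : X) :
    IsLocallyConstant (horo G o x) := by
  have h := (SimpleGraph.reachable_iff_reflTransGen o x).1 (hT.connected.preconnected o x)
  induction h with
  | refl =>
    rw [show horo G o o = fun _ => 0 from funext (horo_self hT o)]
    exact IsLocallyConstant.const 0
  | @tail b c _ hbc ih =>
    let e : DE G := ⟨(b, c), hbc⟩
    have : horo G o c = fun ω =>
        if ω ∈ plusBd G e then horo G o b ω + 1 else horo G o b ω - 1 := by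
      funext ω
      split_ifs with h
      · exact horo_ter_of_mem hT o h
      · rw [← Set.mem_compl_iff, compl_plusBd hT] at h
        exact eq_sub_of_add_eq (horo_ter_of_mem hT o h).symm
    rw [this]
    exact isLocallyConstant_ite_mem (isClopen_plusBd hT e) (ih.comp (· + 1)) (ih.comp (· - 1))

/-- Multiplication by the function `p_z` on the shift space. -/
noncomputable def weight (G : SimpleGraph X) (o : X) (z : ℂ) (f : ChainSp G → ℂ) :
    ChainSp G → ℂ :=
  fun c => z ^ horo G o (ini (c.1 0)) (endB G c) * f c

theorem weight_chainTo {G : SimpleGraph X} (hT : G.IsTree) (o : X) (z : ℂ) (f : ChainSp G → ℂ)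
    (x : X) (ω : Boundary G) :
    weight G o z f (chainTo hT x ω) = z ^ horo G o x ω * f (chainTo hT x ω) := by
  simp [weight]

theorem push_weight_transfer {G : SimpleGraph X} (hT : G.IsTree) (hlf : LocFin G) (o : X) {z : ℂ}
    (hz : z ≠ 0) {f : ChainSp G → ℂ} (hf : f ∈ CcP G) (ω : Boundary G) :
    push G (weight G o z (transfer G f)) ω = z * push G (weight G o z f) ω := by
  obtain ⟨F, hF⟩ := exists_finset_support hT hlf hf
  rw [push_eq_finsum hT, push_eq_sum hT (F := F)
    fun x hx ω => by rw [weight_chainTo, hF x hx, mul_zero]]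
  simp only [weight_chainTo, transfer_eq_sum hT hF, Finset.mul_sum]
  rw [finsum_sum_comm]
  · refine Finset.sum_congr rfl fun y _ => ?_
    rw [finsum_eq_single _ (ter ((chainTo hT y ω).1 0)) fun x hx => by rw [if_neg hx.symm, mul_zero],
      if_pos rfl]
    have := horo_ter hT o (chainTo hT y ω)
    rw [endB_chainTo, ini_chainTo] at this
    rw [this, zpow_add_one₀ hz]
    ring
  · intro y _
    refine (Set.finite_singleton (ter ((chainTo hT y ω).1 0))).subset fun x hx => ?_
    by_contra h
    exact hx (by simp [Ne.symm h])

/-- Multiplication by `ω ↦ z ^ ⟨x, ω⟩` on the locally constant functions on the boundary. -/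
noncomputable def horoMul {G : SimpleGraph X} (hT : G.IsTree) (o : X) (z : ℂ) (x : X) :
    Clc G →ₗ[ℂ] Clc G where
  toFun φ := ⟨fun ω => z ^ horo G o x ω * φ.1 ω,
    ((isLocallyConstant_horo hT o x).comp (z ^ ·)).mul φ.2⟩
  map_add' _ _ := Subtype.ext (funext fun _ => mul_add _ _ _)
  map_smul' _ _ := Subtype.ext (funext fun _ => mul_left_comm _ _ _)

/-- The function on the shift space that is supported on the chains starting at `x` and given
there by a function of the end point. -/
noncomputable def fromVertex {G : SimpleGraph X} (hT : G.IsTree) (hlf : LocFin G) (x : X) :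
    Clc G →ₗ[ℂ] CcP G where
  toFun φ := ⟨fun c => if ini (c.1 0) = x then φ.1 (endB G c) else 0, by
    rw [mem_CcP_iff hT hlf]
    simp only [ini_chainTo, endB_chainTo]
    refine ⟨fun y => ?_, (Set.finite_singleton x).subset fun y hy => ?_⟩
    · split_ifs
      · exact φ.2
      · exact IsLocallyConstant.const 0
    · obtain ⟨ω, hω⟩ := hy
      exact (ite_ne_right_iff.1 hω).1⟩
  map_add' φ ψ := Subtype.ext (funext fun c => by
    by_cases h : ini (c.1 0) = x <;> simp [h])
  map_smul' a φ := Subtype.ext (funext fun c => by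
    by_cases h : ini (c.1 0) = x <;> simp [h])

theorem fromVertex_chainTo {G : SimpleGraph X} (hT : G.IsTree) (hlf : LocFin G) (x y : X)
    (φ : Clc G) (ω : Boundary G) :
    (fromVertex hT hlf x φ).1 (chainTo hT y ω) = if y = x then φ.1 ω else 0 := by
  simp [fromVertex]

theorem chain_funext {G : SimpleGraph X} (hT : G.IsTree) {f g : ChainSp G → ℂ}
    (h : ∀ x ω, f (chainTo hT x ω) = g (chainTo hT x ω)) : f = g :=
  funext fun c => by rw [← chainTo_endB hT c, h]

theorem transfer_fromVertex {G : SimpleGraph X} (hT : G.IsTree) (hlf : LocFin G) {e : DE G}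
    {φ : Clc G} (hφ : ∀ ω ∉ plusBd G e, φ.1 ω = 0) :
    transfer G (fromVertex hT hlf (ini e) φ).1 = (fromVertex hT hlf (ter e) φ).1 := by
  refine chain_funext hT fun x ω => ?_
  rw [transfer_eq_sum hT (F := {ini e})
    fun y hy ω => by rw [fromVertex_chainTo, if_neg (by simpa using hy)],
    Finset.sum_singleton, fromVertex_chainTo, fromVertex_chainTo, if_pos rfl]
  by_cases h : ω ∈ plusBd G e
  · rw [(mem_plusBd_iff hT e ω).1 h]
    simp only [eq_comm]
  · simp [hφ ω h]

theorem pairB_coe {G : SimpleGraph X} (μ : DualB G) (φ : Clc G) : pairB G μ φ.1 = μ φ :=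
  dif_pos φ.2

theorem pairP_coe {G : SimpleGraph X} (lam : DualP G) (f : CcP G) : pairP G lam f.1 = lam f :=
  dif_pos f.2

/-- The restriction to `x` of a function on the shift space, as a function of the end point. -/
noncomputable def atVertex {G : SimpleGraph X} (hT : G.IsTree) (hlf : LocFin G) (x : X)
    (f : CcP G) : Clc G :=
  ⟨fun ω => f.1 (chainTo hT x ω), ((mem_CcP_iff hT hlf).1 f.2).1 x⟩

theorem push_weight_eq_sum {G : SimpleGraph X} (hT : G.IsTree) (hlf : LocFin G) (o : X) (z : ℂ)
    (f : CcP G) {F : Finset X} (hF : ∀ x ∉ F, ∀ ω, f.1 (chainTo hT x ω) = 0) :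
    push G (weight G o z f.1) = (∑ x ∈ F, horoMul hT o z x (atVertex hT hlf x f)).1 := by
  funext ω
  rw [push_eq_sum hT (F := F) fun x hx ω => by rw [weight_chainTo, hF x hx, mul_zero]]
  simp [weight_chainTo, horoMul, atVertex]

theorem eq_sum_fromVertex {G : SimpleGraph X} (hT : G.IsTree) (hlf : LocFin G)
    (f : CcP G) {F : Finset X} (hF : ∀ x ∉ F, ∀ ω, f.1 (chainTo hT x ω) = 0) :
    f = ∑ x ∈ F, fromVertex hT hlf x (atVertex hT hlf x f) := by
  refine Subtype.ext (chain_funext hT fun y ω => ?_)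
  rw [AddSubmonoidClass.coe_finsetSum, Finset.sum_apply]
  simp only [fromVertex_chainTo, atVertex, Finset.sum_ite_eq]
  split_ifs with h
  · rfl
  · exact hF y h ω

theorem push_weight_fromVertex {G : SimpleGraph X} (hT : G.IsTree) (hlf : LocFin G) (o : X) (z : ℂ)
    (φ : Clc G) : push G (weight G o z (fromVertex hT hlf o φ).1) = φ.1 := by
  funext ω
  rw [push_eq_sum hT (F := {o}) fun x hx ω => by
    rw [weight_chainTo, fromVertex_chainTo, if_neg (by simpa using hx), mul_zero]]
  simp [weight_chainTo, fromVertex_chainTo, horo_self hT]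

/-- An eigendistribution is determined by its restriction to the chains starting at `o`. -/
theorem eigen_fromVertex {G : SimpleGraph X} (hT : G.IsTree) (hlf : LocFin G) (o : X) {z : ℂ}
    (hz : z ≠ 0) {lam : DualP G} (hlam : ∀ f : CcP G, pairP G lam (transfer G f.1) = z * lam f)
    (x : X) (φ : Clc G) :
    lam (fromVertex hT hlf x φ) = lam (fromVertex hT hlf o (horoMul hT o z x φ)) := by
  have hstep : ∀ (e : DE G) (φ : Clc G), (∀ ω ∉ plusBd G e, φ.1 ω = 0) →
      lam (fromVertex hT hlf (ter e) φ) = z * lam (fromVertex hT hlf (ini e) φ) ∧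
        horoMul hT o z (ter e) φ = z • horoMul hT o z (ini e) φ := by
    intro e φ hφ
    constructor
    · rw [← hlam, transfer_fromVertex hT hlf hφ, pairP_coe]
    · refine Subtype.ext (funext fun ω => ?_)
      change z ^ horo G o (ter e) ω * φ.1 ω = z * (z ^ horo G o (ini e) ω * φ.1 ω)
      by_cases h : ω ∈ plusBd G e
      · rw [horo_ter_of_mem hT o h, zpow_add_one₀ hz]
        ring
      · simp [hφ ω h]
  have h := (SimpleGraph.reachable_iff_reflTransGen o x).1 (hT.connected.preconnected o x)
  induction h generalizing φ with
  | refl =>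
    congr 2
    exact Subtype.ext (funext fun ω => by simp [horoMul, horo_self hT])
  | @tail b c _ hbc ih =>
    let e : DE G := ⟨(b, c), hbc⟩
    let φ₁ : Clc G := ⟨fun ω => if ω ∈ plusBd G e then φ.1 ω else 0,
      isLocallyConstant_ite_mem (isClopen_plusBd hT e) φ.2 (IsLocallyConstant.const 0)⟩
    let φ₂ : Clc G := ⟨fun ω => if ω ∈ plusBd G e then 0 else φ.1 ω,
      isLocallyConstant_ite_mem (isClopen_plusBd hT e) (IsLocallyConstant.const 0) φ.2⟩
    have hφ : φ = φ₁ + φ₂ := Subtype.ext (funext fun ω => by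
      change φ.1 ω = (if ω ∈ plusBd G e then φ.1 ω else 0) + if ω ∈ plusBd G e then 0 else φ.1 ω
      split_ifs <;> simp)
    obtain ⟨h₁, h₁'⟩ := hstep e φ₁ fun ω hω => if_neg hω
    obtain ⟨h₂, h₂'⟩ := hstep (op e) φ₂ fun ω hω => by
      rw [← compl_plusBd hT, Set.notMem_compl_iff] at hω
      exact if_pos hω
    change lam (fromVertex hT hlf c φ₁) = z * lam (fromVertex hT hlf b φ₁) at h₁
    change horoMul hT o z c φ₁ = z • horoMul hT o z b φ₁ at h₁'
    change lam (fromVertex hT hlf b φ₂) = z * lam (fromVertex hT hlf c φ₂) at h₂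
    change horoMul hT o z b φ₂ = z • horoMul hT o z c φ₂ at h₂'
    rw [hφ]
    simp only [map_add]
    congr 1
    · rw [h₁, h₁', ih, map_smul, map_smul, smul_eq_mul]
    · rw [ih, h₂', map_smul, map_smul, smul_eq_mul] at h₂
      exact (mul_left_cancel₀ hz h₂).symm

/-- The map `μ ↦ p_z · B* μ` is a linear isomorphism from `D'(Ω)` onto
the `z`-eigenspace of the transpose transfer operator in `D'(𝔓)`. -/
theorem statement10 {X : Type} (G : SimpleGraph X) (hT : G.IsTree) (hlf : LocFin G)
    (hnd : ∀ x : X, 2 ≤ deg G x) (o : X) (z : ℂ) (hz : z ≠ 0) :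
    (∀ μ μ' : DualB G,
      (∀ f : ↥(CcP G),
        pairB G μ (push G fun c => z ^ horo G o (ini (c.1 0)) (endB G c) * f.1 c) =
          pairB G μ' (push G fun c => z ^ horo G o (ini (c.1 0)) (endB G c) * f.1 c)) →
        μ = μ') ∧
    (∀ lam : DualP G,
      (∃ μ : DualB G, ∀ f : ↥(CcP G),
        lam f = pairB G μ (push G fun c => z ^ horo G o (ini (c.1 0)) (endB G c) * f.1 c)) ↔
        (∀ f : ↥(CcP G), pairP G lam (transfer G f.1) = z * lam f)) := by
  change (∀ μ μ' : DualB G, (∀ f : CcP G, pairB G μ (push G (weight G o z f.1)) =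
      pairB G μ' (push G (weight G o z f.1))) → μ = μ') ∧
    ∀ lam : DualP G, (∃ μ : DualB G, ∀ f : CcP G,
      lam f = pairB G μ (push G (weight G o z f.1))) ↔ _
  refine ⟨fun μ μ' h => LinearMap.ext fun φ => ?_, fun lam => ⟨?_, fun h => ?_⟩⟩
  · have := h (fromVertex hT hlf o φ)
    rwa [push_weight_fromVertex, pairB_coe, pairB_coe] at this
  · rintro ⟨μ, hμ⟩ f
    rw [← pairP_coe lam f]
    let g : CcP G := ⟨transfer G f.1, transfer_mem_CcP hT hlf f.2⟩
    obtain ⟨F, hF⟩ := exists_finset_support hT hlf f.2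
    have hg : push G (weight G o z g.1) =
        (z • ∑ x ∈ F, horoMul hT o z x (atVertex hT hlf x f)).1 := by
      refine (funext (push_weight_transfer hT hlf o hz f.2)).trans ?_
      rw [push_weight_eq_sum hT hlf o z f hF]
      rfl
    rw [show transfer G f.1 = g.1 from rfl, pairP_coe, pairP_coe, hμ g, hμ f, hg,
      push_weight_eq_sum hT hlf o z f hF, pairB_coe, pairB_coe, map_smul, smul_eq_mul]
  · refine ⟨lam ∘ₗ fromVertex hT hlf o, fun f => ?_⟩
    obtain ⟨F, hF⟩ := exists_finset_support hT hlf f.2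
    rw [push_weight_eq_sum hT hlf o z f hF, pairB_coe]
    conv_lhs => rw [eq_sum_fromVertex hT hlf f hF]
    simp only [map_sum, LinearMap.comp_apply]
    exact Finset.sum_congr rfl fun x _ => eigen_fromVertex hT hlf o hz h x _

end GraphQCC
end

section
/- Let G = (X,E) be a finite connected graph without dead ends. Then: (i) every locally constant function on the shift space 𝔓 depends on only finitely many initial edges, i.e. C^lc(𝔓) = ∪_{N ∈ ℕ} F_{N,𝔸}; (ii) for every z ∈ ℂ ∖ {0}, every F ∈ C^lc(𝔓) with L F = z·F lies in F_{1,𝔸}, i.e. depends only on the first edge of a chain. -/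
open Function Set
open scoped Classical

namespace GraphQCC

variable {X : Type} (G : SimpleGraph X)

variable {G}

variable (G)

variable {G} in
theorem exists_cylinder_subset_of_isOpen {U : Set (ChainSp G)} (hU : IsOpen U) :
    ∀ c ∈ U, ∃ n : ℕ, ∀ c' : ChainSp G, (∀ i < n, c'.1 i = c.1 i) → c' ∈ U := by
  induction hU with
  | basic s hs =>
    obtain ⟨c₀, n, rfl⟩ := hs
    exact fun c hc => ⟨n + 1, fun c' h i hi => (h i (by omega)).trans (hc i hi)⟩
  | univ => exact fun c _ => ⟨0, fun _ _ => trivial⟩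
  | inter s t _ _ ihs iht =>
    rintro c ⟨hs, ht⟩
    obtain ⟨n, hn⟩ := ihs c hs
    obtain ⟨m, hm⟩ := iht c ht
    exact ⟨max n m, fun c' h => ⟨hn c' fun i hi => h i (lt_max_of_lt_left hi),
      hm c' fun i hi => h i (lt_max_of_lt_right hi)⟩⟩
  | sUnion S _ ih =>
    rintro c ⟨s, hs, hc⟩
    obtain ⟨n, hn⟩ := ih s hs c hc
    exact ⟨n, fun c' h => ⟨s, hs, hn c' h⟩⟩

variable {G} in
theorem isLocallyConstant_of_mem_cylFun {F : ChainSp G → ℂ} {N : ℕ} (hF : F ∈ cylFun G N) :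
    IsLocallyConstant F := by
  rw [IsLocallyConstant.iff_exists_open]
  exact fun c => ⟨{c' | ∀ i ≤ N, c'.1 i = c.1 i},
    TopologicalSpace.isOpen_generateFrom_of_mem ⟨c, N, rfl⟩, fun _ _ => rfl,
    fun c' h => hF c' c fun i hi => h i hi.le⟩

variable {G} in
/-- Sequential compactness of the shift space along an ultrafilter. -/
theorem exists_eventually_eq_of_ultrafilter [Finite X] (𝒰 : Ultrafilter ℕ) (c : ℕ → ChainSp G) :
    ∃ l : ChainSp G, ∀ i, ∀ᶠ n in (𝒰 : Filter ℕ), (c n).1 i = l.1 i := by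
  have h (i : ℕ) : ∃ e : DE G, ∀ᶠ n in (𝒰 : Filter ℕ), (c n).1 i = e := by
    obtain ⟨e, he⟩ := Ultrafilter.eq_pure_of_finite (𝒰.map fun n => (c n).1 i)
    refine ⟨e, ?_⟩
    have : ({e} : Set (DE G)) ∈ 𝒰.map fun n => (c n).1 i := by
      rw [he]
      exact Filter.mem_pure.2 rfl
    exact this
  choose l hl using h
  refine ⟨⟨l, fun i => ?_⟩, hl⟩
  obtain ⟨n, h₀, h₁⟩ := ((hl i).and (hl (i + 1))).exists
  simpa only [h₀, h₁] using (c n).2 i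

variable {G} in
theorem exists_mem_cylFun_of_isLocallyConstant [Finite X] {F : ChainSp G → ℂ}
    (hF : IsLocallyConstant F) : ∃ N, F ∈ cylFun G N := by
  by_contra! hN
  simp only [cylFun, Set.mem_ofPred_eq, not_forall] at hN
  choose c d hcd hne using hN
  obtain ⟨l, hl⟩ := exists_eventually_eq_of_ultrafilter (Filter.hyperfilter ℕ) c
  obtain ⟨n, hn⟩ := exists_cylinder_subset_of_isOpen (hF {F l}) l rfl
  have hc : ∀ᶠ N in (Filter.hyperfilter ℕ : Filter ℕ), ∀ i < n, (c N).1 i = l.1 i :=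
    (Filter.eventually_all_finite (Set.finite_lt_nat n)).2 fun i _ => hl i
  have hlarge : ∀ᶠ N in (Filter.hyperfilter ℕ : Filter ℕ), n ≤ N :=
    Filter.Tendsto.eventually_ge_atTop
      (Filter.tendsto_id.mono_left Nat.hyperfilter_le_atTop) n
  obtain ⟨N, hcN, hnN⟩ := (hc.and hlarge).exists
  have h₁ : F (c N) = F l := hn (c N) hcN
  have h₂ : F (d N) = F l :=
    hn (d N) fun i hi => (hcd N i (hi.trans_le hnN)).symm.trans (hcN i hi)
  exact hne N (h₁.trans h₂.symm)

variable {G} in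
/-- Replace the tail `c` of a chain by a tail `d` with the same first edge. -/
def replaceTail {c d : ChainSp G} (h : c.1 0 = d.1 0) (b : {b : ChainSp G // shift G b = c}) :
    {b : ChainSp G // shift G b = d} :=
  ⟨⟨fun n => Nat.casesOn n (b.1.1 0) d.1, fun i => by
    cases i with
    | zero =>
      have h₁ : b.1.1 1 = d.1 0 := (congrArg (fun a => a.1 0) b.2).trans h
      have h₂ := b.1.2 0
      simp only [zero_add, h₁] at h₂
      exact h₂
    | succ i => exact d.2 i⟩, rfl⟩

variable {G} in
theorem replaceTail_replaceTail {c d : ChainSp G} (h : c.1 0 = d.1 0)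
    (b : {b : ChainSp G // shift G b = c}) : replaceTail h.symm (replaceTail h b) = b := by
  apply Subtype.ext
  apply Subtype.ext
  funext n
  cases n with
  | zero => rfl
  | succ n => exact (congrArg (fun a => a.1 n) b.2).symm

variable {G} in
/-- Chains prolonging `c` by one edge correspond to those prolonging `d` by one edge. -/
def replaceTailEquiv {c d : ChainSp G} (h : c.1 0 = d.1 0) :
    {b : ChainSp G // shift G b = c} ≃ {b : ChainSp G // shift G b = d} where
  toFun := replaceTail h
  invFun := replaceTail h.symm
  left_inv := replaceTail_replaceTail h
  right_inv := replaceTail_replaceTail h.symm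

variable {G} in
theorem transfer_mem_cylFun {F : ChainSp G → ℂ} {N : ℕ} (hF : F ∈ cylFun G (N + 2)) :
    transfer G F ∈ cylFun G (N + 1) := by
  intro c d hcd
  have h := hcd 0 N.succ_pos
  have key (b : {b : ChainSp G // shift G b = c}) : F b = F (replaceTailEquiv h b) := by
    refine hF _ _ fun i hi => ?_
    cases i with
    | zero => rfl
    | succ i => exact (congrArg (fun a => a.1 i) b.2).trans (hcd i (by omega))
  unfold transfer
  rw [← finsum_set_coe_eq_finsum_mem, ← finsum_set_coe_eq_finsum_mem]
  exact finsum_eq_of_bijective (replaceTailEquiv h) (replaceTailEquiv h).bijective key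

variable {G} in
theorem mem_cylFun_one_of_transfer_eq {z : ℂ} (hz : z ≠ 0) {F : ChainSp G → ℂ}
    (hF : ∀ c, transfer G F c = z * F c) {N : ℕ} (hN : F ∈ cylFun G N) : F ∈ cylFun G 1 := by
  induction N with
  | zero => exact fun c d _ => hN c d fun i hi => absurd hi i.not_lt_zero
  | succ N ih =>
    cases N with
    | zero => exact hN
    | succ N =>
      refine ih fun c d hcd => mul_left_cancel₀ hz ?_
      rw [← hF c, ← hF d]
      exact transfer_mem_cylFun hN c d hcd

/-- For a finite graph: (i) every locally constant function on the shift
space depends on finitely many initial edges; (ii) transfer-operator eigenfunctions with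
nonzero eigenvalue depend only on the first edge. -/
theorem statement11 {X : Type} [Finite X] (G : SimpleGraph X) (hconn : G.Connected)
    (hnd : ∀ x : X, 2 ≤ deg G x) :
    ({F : ChainSp G → ℂ | IsLocallyConstant F} = ⋃ N : ℕ, cylFun G N) ∧
    (∀ z : ℂ, z ≠ 0 → ∀ F : ChainSp G → ℂ, IsLocallyConstant F →
      (∀ c : ChainSp G, transfer G F c = z * F c) → F ∈ cylFun G 1) := by
  refine ⟨?_, fun z hz F hF hL => ?_⟩
  · ext F
    rw [Set.mem_iUnion]
    exact ⟨exists_mem_cylFun_of_isLocallyConstant,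
      fun ⟨_, hN⟩ => isLocallyConstant_of_mem_cylFun hN⟩
  · obtain ⟨N, hN⟩ := exists_mem_cylFun_of_isLocallyConstant hF
    exact mem_cylFun_one_of_transfer_eq hz hL hN

end GraphQCC
end

section
/- Let G = (X,E) be a finite connected graph without dead ends. Then the dimension of the 1-eigenspace of the edge Laplacian satisfies: dim_ℂ E_1(Δᵉ; Maps(E,ℂ)) = c(G) if c(G) ≠ 1, and dim_ℂ E_1(Δᵉ; Maps(E,ℂ)) = 2 if c(G) = 1. -/
open Function Set
open scoped Classical

namespace GraphQCC

variable {X : Type} (G : SimpleGraph X)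

variable {G}

variable (G)

section DirectedEdges

variable {G}

lemma ini_op (e : DE G) : ini (op e) = ter e := rfl

lemma ter_op (e : DE G) : ter (op e) = ini e := rfl

lemma op_op (e : DE G) : op (op e) = e := rfl

lemma op_ne (e : DE G) : op e ≠ e := fun h => e.2.ne (congrArg ter h)

/-- The undirected edge underlying a directed edge. -/
def undir (e : DE G) : G.edgeSet := ⟨s(e.1.1, e.1.2), e.2⟩

lemma undir_op (e : DE G) : undir (op e) = undir e := Subtype.ext Sym2.eq_swap

lemma undir_eq_iff {e e' : DE G} : undir e = undir e' ↔ e = e' ∨ e = op e' := by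
  obtain ⟨⟨a, b⟩, h⟩ := e
  obtain ⟨⟨c, d⟩, h'⟩ := e'
  rw [Subtype.ext_iff]
  simp [undir, op]

lemma undir_surjective : Surjective (undir : DE G → G.edgeSet) := by
  rintro ⟨ε, hε⟩
  induction ε with
  | h x y => exact ⟨⟨(x, y), hε⟩, rfl⟩

/-- A chosen orientation of an undirected edge. -/
noncomputable def orient : G.edgeSet → DE G := surjInv undir_surjective

lemma undir_orient (ε : G.edgeSet) : undir (orient ε) = ε := surjInv_eq undir_surjective ε

lemma orient_injective : Injective (orient : G.edgeSet → DE G) :=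
  injective_surjInv undir_surjective

lemma op_orient_ne (ε ε' : G.edgeSet) : op (orient ε) ≠ orient ε' := fun h => by
  have h' : ε = ε' := by rw [← undir_orient ε, ← undir_op, h, undir_orient]
  exact op_ne _ (h' ▸ h)

lemma eq_orient_or (e : DE G) : e = orient (undir e) ∨ e = op (orient (undir e)) :=
  undir_eq_iff.1 (undir_orient _).symm

lemma eq_of_forall_ini_eq_ter {α : Type*} (hconn : G.Connected) {u : X → α}
    (hu : ∀ e : DE G, u (ini e) = u (ter e)) (x y : X) : u x = u y := by
  obtain ⟨w⟩ := hconn.preconnected x y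
  induction w with
  | nil => rfl
  | cons h _ ih => exact (hu ⟨(_, _), h⟩).trans ih

end DirectedEdges

section Flows

variable [Fintype X]

/-- The total value of `f` on the edges starting at `x`. -/
noncomputable def outSum (f : DE G → ℂ) (x : X) : ℂ := ∑ e with ini e = x, f e

lemma edgeLap_eq (f : DE G → ℂ) (e : DE G) :
    edgeLap G f e = outSum G f (ter e) - f (op e) := by
  have hs : {e' : DE G | ini e' = ter e ∧ e' ≠ op e} =
      ((Finset.univ.filter fun e' : DE G => ini e' = ter e).erase (op e) : Finset (DE G)) := by
    ext e'
    simp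
  rw [edgeLap, hs, finsum_mem_coe_finset, outSum,
    ← Finset.add_sum_erase {e' : DE G | ini e' = ter e} f (a := op e) (by simp [ini_op])]
  ring

lemma sum_outSum (f : DE G → ℂ) : ∑ x, outSum G f x = ∑ e, f e :=
  Finset.sum_fiberwise _ _ _

/-- The antisymmetric edge functions whose outgoing sum vanishes at every vertex. -/
noncomputable def flows : Submodule ℂ (DE G → ℂ) where
  carrier := {f | (∀ e, f (op e) = -f e) ∧ ∀ x, outSum G f x = 0}
  add_mem' {f g} hf hg := by
    refine ⟨fun e => ?_, fun x => ?_⟩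
    · simp [hf.1, hg.1]; ring
    · have hf' := hf.2 x
      have hg' := hg.2 x
      simp only [outSum] at hf' hg' ⊢
      simp [Finset.sum_add_distrib, hf', hg']
  zero_mem' := by simp [outSum]
  smul_mem' c f hf := by
    refine ⟨fun e => by simp [hf.1], fun x => ?_⟩
    have hf' := hf.2 x
    simp only [outSum] at hf' ⊢
    simp [← Finset.mul_sum, hf']

/-- The matrix extending a function on oriented edges antisymmetrically to directed edges. -/
noncomputable def extMatrix : Matrix (DE G) G.edgeSet ℂ :=
  Matrix.of fun e ε => (if e = orient ε then 1 else 0) - (if e = op (orient ε) then 1 else 0)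

/-- The matrix of the operator `outSum`. -/
noncomputable def outMatrix : Matrix X (DE G) ℂ :=
  Matrix.of fun x e => if ini e = x then 1 else 0

lemma outMatrix_mulVec (f : DE G → ℂ) : (outMatrix G).mulVec f = outSum G f := by
  ext x
  simp [outMatrix, Matrix.mulVec, dotProduct, outSum, Finset.sum_filter]

lemma outMatrix_transpose_mulVec (u : X → ℂ) (e : DE G) :
    (outMatrix G).transpose.mulVec u e = u (ini e) := by
  simp [outMatrix, Matrix.mulVec, dotProduct]

lemma extMatrix_transpose_mulVec (f : DE G → ℂ) (ε : G.edgeSet) :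
    (extMatrix G).transpose.mulVec f ε = f (orient ε) - f (op (orient ε)) := by
  simp [extMatrix, Matrix.mulVec, dotProduct, sub_mul, Finset.sum_sub_distrib]

lemma extMatrix_mulVec_orient (g : G.edgeSet → ℂ) (ε : G.edgeSet) :
    (extMatrix G).mulVec g (orient ε) = g ε := by
  simp [extMatrix, Matrix.mulVec, dotProduct, (op_orient_ne _ _).symm, orient_injective.eq_iff]

lemma extMatrix_mulVec_op (g : G.edgeSet → ℂ) (e : DE G) :
    (extMatrix G).mulVec g (op e) = -(extMatrix G).mulVec g e := by
  have h1 (e e' : DE G) : op e = op e' ↔ e = e' :=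
    (LeftInverse.injective (g := op) op_op).eq_iff
  have h2 (e e' : DE G) : op e = e' ↔ e = op e' := by rw [← h1, op_op]
  simp only [extMatrix, Matrix.mulVec, dotProduct, Matrix.of_apply, h1, h2,
    ← Finset.sum_neg_distrib]
  exact Finset.sum_congr rfl fun _ _ => by ring

lemma extMatrix_mulVec_comp_orient {f : DE G → ℂ} (hf : ∀ e, f (op e) = -f e) :
    (extMatrix G).mulVec (f ∘ orient) = f := by
  ext e
  rcases eq_orient_or e with h | h <;> rw [h]
  · exact extMatrix_mulVec_orient G _ _
  · rw [extMatrix_mulVec_op, extMatrix_mulVec_orient, hf, comp_apply]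

lemma flows_eq_map :
    flows G = (outMatrix G * extMatrix G).mulVecLin.ker.map (extMatrix G).mulVecLin := by
  ext f
  constructor
  · intro hf
    refine ⟨f ∘ orient, ?_, extMatrix_mulVec_comp_orient G hf.1⟩
    simp only [SetLike.mem_coe, LinearMap.mem_ker, Matrix.mulVecLin_apply]
    rw [← Matrix.mulVec_mulVec, extMatrix_mulVec_comp_orient G hf.1, outMatrix_mulVec]
    exact funext hf.2
  · rintro ⟨g, hg, rfl⟩
    simp only [SetLike.mem_coe, LinearMap.mem_ker, Matrix.mulVecLin_apply] at hg
    rw [← Matrix.mulVec_mulVec, outMatrix_mulVec] at hg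
    exact ⟨extMatrix_mulVec_op G g, congrFun hg⟩

variable {G}

lemma ker_transpose_eq_span (hconn : G.Connected) :
    (outMatrix G * extMatrix G).transpose.mulVecLin.ker = Submodule.span ℂ {1} := by
  ext u
  rw [LinearMap.mem_ker, Matrix.mulVecLin_apply, Matrix.transpose_mul, ← Matrix.mulVec_mulVec,
    Submodule.mem_span_singleton]
  constructor
  · intro hu
    have hε (ε : G.edgeSet) : u (ini (orient ε)) = u (ter (orient ε)) := by
      have := congrFun hu ε
      rwa [extMatrix_transpose_mulVec, outMatrix_transpose_mulVec, outMatrix_transpose_mulVec,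
        Pi.zero_apply, sub_eq_zero] at this
    have he (e : DE G) : u (ini e) = u (ter e) := by
      rcases eq_orient_or e with h | h <;> rw [h]
      · exact hε _
      · exact (hε _).symm
    obtain ⟨o⟩ := hconn.nonempty
    exact ⟨u o, funext fun x => by simpa using eq_of_forall_ini_eq_ter hconn he o x⟩
  · rintro ⟨c, rfl⟩
    ext ε
    simp [extMatrix_transpose_mulVec, outMatrix_transpose_mulVec]

lemma finrank_flows (hconn : G.Connected) :
    (Module.finrank ℂ (flows G) : ℤ) = cyclo G := by
  have hinj : Injective (extMatrix G).mulVecLin := fun g g' h => by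
    ext ε
    simpa [extMatrix_mulVec_orient] using congrFun h (orient ε)
  have := hconn.nonempty
  have h1 : Module.finrank ℂ (flows G) =
      Module.finrank ℂ (outMatrix G * extMatrix G).mulVecLin.ker := by
    rw [flows_eq_map]
    exact (Submodule.equivMapOfInjective _ hinj _).finrank_eq.symm
  have h2 := (outMatrix G * extMatrix G).mulVecLin.finrank_range_add_finrank_ker
  have h3 := (outMatrix G * extMatrix G).transpose.mulVecLin.finrank_range_add_finrank_ker
  rw [ker_transpose_eq_span hconn, finrank_span_singleton one_ne_zero] at h3
  have h4 := (outMatrix G * extMatrix G).rank_transpose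
  simp only [Matrix.rank] at h4
  simp only [Module.finrank_fintype_fun_eq_card, ← Nat.card_eq_fintype_card] at h2 h3
  rw [cyclo]
  omega

lemma card_DE : Fintype.card (DE G) = 2 * Nat.card G.edgeSet := by
  rw [Nat.card_eq_fintype_card, ← SimpleGraph.edgeFinset_card,
    ← SimpleGraph.dart_card_eq_twice_card_edges]
  exact Fintype.card_congr
    ⟨fun e => ⟨e.1, e.2⟩, fun d => ⟨d.toProd, d.adj⟩, fun _ => rfl, fun _ => rfl⟩

lemma sum_op (f : DE G → ℂ) : ∑ e, f (op e) = ∑ e, f e :=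
  Equiv.sum_comp ⟨op, op, op_op, op_op⟩ f

lemma deg_eq_card (x : X) : deg G x = (Finset.univ.filter fun e : DE G => ini e = x).card := by
  rw [deg, ← Set.ncard_coe_finset]
  simp

lemma mem_edgeEigSub_one {hlf : LocFin G} {f : DE G → ℂ} :
    f ∈ edgeEigSub G hlf 1 ↔ ∀ e, outSum G f (ter e) = f e + f (op e) := by
  change (∀ e, edgeLap G f e = 1 * f e) ↔ _
  simp only [edgeLap_eq, one_mul, sub_eq_iff_eq_add]

/-- For an eigenfunction, the outgoing sums and the edge symmetrizations share one value. -/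
lemma exists_const_of_mem (hconn : G.Connected) {hlf : LocFin G} {f : DE G → ℂ}
    (hf : f ∈ edgeEigSub G hlf 1) :
    ∃ s, (∀ x, outSum G f x = s) ∧ ∀ e, f e + f (op e) = s := by
  rw [mem_edgeEigSub_one] at hf
  obtain ⟨o⟩ := hconn.nonempty
  have h := eq_of_forall_ini_eq_ter hconn (u := outSum G f) fun e => by
    rw [hf e, ← ter_op, hf, op_op, add_comm]
  exact ⟨outSum G f o, fun x => h x o, fun e => by rw [← hf, h]⟩

lemma card_edges_mul_eq {f : DE G → ℂ} {s : ℂ} (hs : ∀ x, outSum G f x = s)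
    (hs' : ∀ e, f e + f (op e) = s) : (Nat.card G.edgeSet : ℂ) * s = Nat.card X * s := by
  have h1 : ∑ e, f e = Nat.card X * s := by
    rw [← sum_outSum]
    simp [hs]
  have h2 : ∑ e : DE G, (f e + f (op e)) = 2 * Nat.card G.edgeSet * s := by
    simp only [hs', Finset.sum_const, Finset.card_univ, card_DE, nsmul_eq_mul]
    push_cast
    ring
  rw [Finset.sum_add_distrib, sum_op, h1] at h2
  linear_combination -h2 / 2

lemma mem_flows_iff {hlf : LocFin G} {f : DE G → ℂ} :
    f ∈ flows G ↔ f ∈ edgeEigSub G hlf 1 ∧ ∀ x, outSum G f x = 0 := by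
  constructor
  · intro hf
    exact ⟨mem_edgeEigSub_one.2 fun e => by rw [hf.2, hf.1, add_neg_cancel], hf.2⟩
  · rintro ⟨hf, h0⟩
    refine ⟨fun e => ?_, h0⟩
    have := mem_edgeEigSub_one.1 hf e
    rw [h0] at this
    linear_combination -this

lemma deg_eq_two (hnd : ∀ x : X, 2 ≤ deg G x) (hc : cyclo G = 1) (x : X) : deg G x = 2 := by
  have hsum : ∑ x, deg G x = ∑ _x : X, 2 := by
    have h : ∑ x, deg G x = Fintype.card (DE G) := by
      simp only [deg_eq_card]
      exact (Finset.card_eq_sum_card_fiberwise fun _ _ => Finset.mem_univ _).symm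
    rw [h, card_DE, Finset.sum_const, Finset.card_univ, ← Nat.card_eq_fintype_card, smul_eq_mul]
    rw [cyclo] at hc
    omega
  exact ((Finset.sum_eq_sum_iff_of_le fun x _ => hnd x).1 hsum.symm x (Finset.mem_univ x)).symm

lemma outSum_const (c : ℂ) (x : X) : outSum G (fun _ => c) x = deg G x * c := by
  rw [outSum, deg_eq_card, Finset.sum_const, nsmul_eq_mul]

lemma edgeEigSub_one_eq_flows (hconn : G.Connected) (hlf : LocFin G) (hc : cyclo G ≠ 1) :
    edgeEigSub G hlf 1 = flows G := by
  ext f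
  rw [mem_flows_iff (hlf := hlf), iff_self_and]
  intro hf
  obtain ⟨s, hs, hs'⟩ := exists_const_of_mem hconn hf
  have h := card_edges_mul_eq hs hs'
  have hs0 : s = 0 := by
    by_contra h0
    refine hc ?_
    have : Nat.card G.edgeSet = Nat.card X := by exact_mod_cast mul_right_cancel₀ h0 h
    rw [cyclo]
    omega
  exact fun x => (hs x).trans hs0

lemma edgeEigSub_one_eq_sup (hconn : G.Connected) (hlf : LocFin G)
    (hdeg : ∀ x, deg G x = 2) :
    edgeEigSub G hlf 1 = flows G ⊔ Submodule.span ℂ {1} := by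
  have hone : (1 : DE G → ℂ) ∈ edgeEigSub G hlf 1 := mem_edgeEigSub_one.2 fun e => by
    refine (outSum_const 1 (ter e)).trans ?_
    norm_num [hdeg]
  apply le_antisymm
  · intro f hf
    obtain ⟨s, hs, -⟩ := exists_const_of_mem hconn hf
    refine Submodule.mem_sup.2 ⟨f - (s / 2) • 1, ?_, (s / 2) • 1,
      Submodule.smul_mem _ _ (Submodule.mem_span_singleton_self _), sub_add_cancel _ _⟩
    refine (mem_flows_iff (hlf := hlf)).2
      ⟨Submodule.sub_mem _ hf (Submodule.smul_mem _ _ hone), fun x => ?_⟩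
    have h1 := hs x
    have h2 := outSum_const (G := G) (s / 2) x
    rw [hdeg] at h2
    simp only [outSum] at h1 h2 ⊢
    simp only [Pi.sub_apply, Pi.smul_apply, Pi.one_apply, smul_eq_mul, mul_one,
      Finset.sum_sub_distrib, h1, h2]
    push_cast
    ring
  · refine sup_le (fun f hf => (mem_flows_iff.1 hf).1) ?_
    rwa [Submodule.span_singleton_le_iff_mem]

lemma flows_inf_span_one (hne : Nonempty (DE G)) :
    flows G ⊓ Submodule.span ℂ {1} = ⊥ := by
  rw [eq_bot_iff]
  rintro f ⟨hf, hf'⟩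
  obtain ⟨c, rfl⟩ := Submodule.mem_span_singleton.1 hf'
  obtain ⟨e⟩ := hne
  have h := hf.1 e
  simp only [Pi.smul_apply, Pi.one_apply, smul_eq_mul, mul_one] at h
  simp [self_eq_neg.1 h]

end Flows

/-- Dimension of the `1`-eigenspace of the edge Laplacian of a finite
graph in terms of the cyclomatic number. -/
theorem statement14 {X : Type} [Finite X] (G : SimpleGraph X) (hconn : G.Connected)
    (hnd : ∀ x : X, 2 ≤ deg G x) (hlf : LocFin G) :
    (cyclo G ≠ 1 → (Module.finrank ℂ ↥(edgeEigSub G hlf 1) : ℤ) = cyclo G) ∧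
    (cyclo G = 1 → Module.finrank ℂ ↥(edgeEigSub G hlf 1) = 2) := by
  have := Fintype.ofFinite X
  refine ⟨fun hc => ?_, fun hc => ?_⟩
  · rw [edgeEigSub_one_eq_flows hconn hlf hc, finrank_flows hconn]
  · have hdeg := deg_eq_two hnd hc
    have hne : Nonempty (DE G) := by
      obtain ⟨o⟩ := hconn.nonempty
      obtain ⟨e, -⟩ := Set.nonempty_of_ncard_ne_zero
        (s := {e : DE G | ini e = o}) (by have := hdeg o; rw [deg] at this; omega)
      exact ⟨e⟩
    have h := Submodule.finrank_sup_add_finrank_inf_eq (flows G) (Submodule.span ℂ {1})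
    rw [flows_inf_span_one hne, finrank_bot, finrank_span_singleton one_ne_zero,
      ← edgeEigSub_one_eq_sup hconn hlf hdeg] at h
    have := finrank_flows hconn
    omega

end GraphQCC
end
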